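/- arXiv:2006.07413 — 4 statements merged into one kernel-verified Lean document; each statement's English description precedes it below -/
import Mathlib

section
/- Let n ≥ 3 and let V : ZMod n → ℝ³ be a family of vectors with det(V_{i-1}, V_i, V_{i+1}) ≠ 0 for all i, and let G be Glick's operator of V. Let t : ZMod n → ℝ satisfy t_i ≠ 0 for all i. Then the family V' defined by V'_i = t_i • V_i also satisfies det(V'_{i-1}, V'_i, V'_{i+1}) ≠ 0 for all i, and Glick's operator of V' equals G. (Glick's operator is invariant under rescaling of the lifts of the vertices.) -/
/-- `det3 A B C` is the determinant of the 3×3 real matrix with columns `A`, `B`, `C`. -/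
noncomputable def det3 (A B C : Fin 3 → ℝ) : ℝ := (Matrix.of ![A, B, C]).transpose.det

/-- Glick's operator of a family of lifts `V : ZMod n → ℝ³`:
`G(W) = n • W − ∑ i, (det(V_{i-1}, W, V_{i+1}) / det(V_{i-1}, V_i, V_{i+1})) • V_i`. -/
noncomputable def glick (n : ℕ) (V : ZMod n → Fin 3 → ℝ) (W : Fin 3 → ℝ) : Fin 3 → ℝ :=
  (n : ℝ) • W - ∑ i ∈ Finset.range n,
    (det3 (V ((i : ZMod n) - 1)) W (V ((i : ZMod n) + 1)) /
      det3 (V ((i : ZMod n) - 1)) (V (i : ZMod n)) (V ((i : ZMod n) + 1))) • V (i : ZMod n)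

theorem det3_smul (a b c : ℝ) (A B C : Fin 3 → ℝ) :
    det3 (a • A) (b • B) (c • C) = a * b * c * det3 A B C := by
  simp [det3, Matrix.det_fin_three]
  ring

/-- Glick's operator is invariant under rescaling of the lifts of the vertices. -/
theorem glick_invariant_of_rescaling (n : ℕ) (hn : 3 ≤ n) (V : ZMod n → Fin 3 → ℝ)
    (hV : ∀ i : ZMod n, det3 (V (i - 1)) (V i) (V (i + 1)) ≠ 0)
    (t : ZMod n → ℝ) (ht : ∀ i, t i ≠ 0) :
    (∀ i : ZMod n,
      det3 (t (i - 1) • V (i - 1)) (t i • V i) (t (i + 1) • V (i + 1)) ≠ 0) ∧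
    ∀ W : Fin 3 → ℝ, glick n (fun i => t i • V i) W = glick n V W := by
  refine ⟨fun i => ?_, fun W => ?_⟩
  · rw [det3_smul]
    exact mul_ne_zero (mul_ne_zero (mul_ne_zero (ht _) (ht _)) (ht _)) (hV i)
  · unfold glick
    congr 1
    refine Finset.sum_congr rfl fun i _ => ?_
    have hW := det3_smul (t ((i : ZMod n) - 1)) 1 (t ((i : ZMod n) + 1))
      (V ((i : ZMod n) - 1)) W (V ((i : ZMod n) + 1))
    rw [one_smul] at hW
    simp only [hW, det3_smul, smul_smul]
    congr 1
    have h₀ := ht ((i : ZMod n) - 1)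
    have h₁ := ht (i : ZMod n)
    have h₂ := ht ((i : ZMod n) + 1)
    have hD := hV (i : ZMod n)
    field_simp
end

section
/- Let V_1, V_2, V_3, V_4, V_5 ∈ ℝ³ (indices taken modulo 5) satisfy det(V_{i-1}, V_i, V_{i+1}) ≠ 0 for all i, and let G be Glick's operator of this 5-tuple. Then G(V_1) − 3·V_1 lies in the intersection of the linear spans span{V_2, V_4} and span{V_3, V_5}. (The point of the projective plane represented by (G − 3I)(V_1) is the intersection of the diagonals (v_2 v_4) and (v_3 v_5) of the pentagon.) -/
theorem det3_eq (A B C : Fin 3 → ℝ) :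
    det3 A B C = A 0 * (B 1 * C 2 - B 2 * C 1) - B 0 * (A 1 * C 2 - A 2 * C 1)
      + C 0 * (A 1 * B 2 - A 2 * B 1) := by
  simp only [det3, Matrix.det_transpose, Matrix.det_fin_three, Matrix.of_apply,
    Matrix.cons_val]
  ring

/-- Cramer's rule in `ℝ³`. -/
theorem cramer_det3 {A B C : Fin 3 → ℝ} (h : det3 A B C ≠ 0) (W : Fin 3 → ℝ) :
    W = (det3 W B C / det3 A B C) • A + (det3 A W C / det3 A B C) • B
      + (det3 A B W / det3 A B C) • C := by
  have key : det3 A B C • W = det3 W B C • A + det3 A W C • B + det3 A B W • C := by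
    ext k
    simp only [Pi.add_apply, Pi.smul_apply, smul_eq_mul, det3_eq]
    fin_cases k <;> simp <;> ring
  rw [div_eq_inv_mul, div_eq_inv_mul, div_eq_inv_mul, mul_smul, mul_smul, mul_smul,
    ← smul_add, ← smul_add, ← key, inv_smul_smul₀ h]

theorem det3_self_left (A C : Fin 3 → ℝ) : det3 A A C = 0 := by
  rw [det3_eq]; ring

theorem det3_self_right (A B : Fin 3 → ℝ) : det3 A B B = 0 := by
  rw [det3_eq]; ring

theorem pentagon_glick_sub_three_smul (V : ZMod 5 → Fin 3 → ℝ)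
    (h : det3 (V 0) (V 1) (V 2) ≠ 0) :
    glick 5 V (V 1) - (3 : ℝ) • V 1 =
      V 1 - (det3 (V 2) (V 1) (V 4) / det3 (V 2) (V 3) (V 4)) • V 3
        - (det3 (V 3) (V 1) (V 0) / det3 (V 3) (V 4) (V 0)) • V 4 := by
  have e0 : (0 : ZMod 5) + 1 = 1 := by decide
  have e1 : (1 : ZMod 5) - 1 = 0 := by decide
  have e2 : (2 : ZMod 5) - 1 = 1 := by decide
  have e3 : (3 : ZMod 5) - 1 = 2 := by decide
  have e4 : (3 : ZMod 5) + 1 = 4 := by decide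
  have e5 : (4 : ZMod 5) - 1 = 3 := by decide
  have e6 : (4 : ZMod 5) + 1 = 0 := by decide
  have e7 : (1 : ZMod 5) + 1 = 2 := by decide
  simp only [glick, Finset.sum_range_succ, Finset.sum_range_zero, Nat.cast_zero, Nat.cast_one,
    Nat.cast_ofNat, e0, e1, e2, e3, e4, e5, e6, e7, det3_self_left, det3_self_right, zero_div,
    zero_smul, div_self h, one_smul]
  module

/-- For a pentagon, `(G − 3I)(V₁)` lies on both diagonals `(v₂v₄)` and `(v₃v₅)`. -/
theorem pentagon_glick_mem_diagonals (V : ZMod 5 → Fin 3 → ℝ)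
    (hV : ∀ i : ZMod 5, det3 (V (i - 1)) (V i) (V (i + 1)) ≠ 0) :
    glick 5 V (V 1) - (3 : ℝ) • V 1 ∈
      Submodule.span ℝ {V 2, V 4} ⊓ Submodule.span ℝ {V 3, V 5} := by
  have h1 : det3 (V 0) (V 1) (V 2) ≠ 0 := hV 1
  have h3 : det3 (V 2) (V 3) (V 4) ≠ 0 := hV 3
  have h4 : det3 (V 3) (V 4) (V 0) ≠ 0 := hV 4
  have e : (5 : ZMod 5) = 0 := by decide
  rw [pentagon_glick_sub_three_smul V h1, e, Submodule.mem_inf, Submodule.mem_span_pair,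
    Submodule.mem_span_pair]
  constructor
  · refine ⟨det3 (V 1) (V 3) (V 4) / det3 (V 2) (V 3) (V 4),
      det3 (V 2) (V 3) (V 1) / det3 (V 2) (V 3) (V 4)
        - det3 (V 3) (V 1) (V 0) / det3 (V 3) (V 4) (V 0), ?_⟩
    linear_combination (norm := module) (-1 : ℝ) • cramer_det3 h3 (V 1)
  · refine ⟨det3 (V 1) (V 4) (V 0) / det3 (V 3) (V 4) (V 0)
        - det3 (V 2) (V 1) (V 4) / det3 (V 2) (V 3) (V 4),
      det3 (V 3) (V 4) (V 1) / det3 (V 3) (V 4) (V 0), ?_⟩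
    linear_combination (norm := module) (-1 : ℝ) • cramer_det3 h4 (V 1)
end

section
/- Let W, X, Y, Z ∈ ℝ³ and a, b, c ∈ ℝ satisfy Z = a·Y + b·X + c·W, with det(W, X, Y) ≠ 0 and c ≠ 0. Let S : ℝ³ → ℝ³ be a linear map such that S(X) = 0, S(Y) = 0, and S(Z) = −b·X − c·W. Then for every V ∈ ℝ³, S(V) = (det(V, X, Y)/det(W, X, Y))·(−W − (b/c)·X). -/
/-- Cramer's rule in `ℝ³`, without division. -/
theorem det3_smul_eq (W X Y V : Fin 3 → ℝ) :
    det3 W X Y • V = det3 V X Y • W + det3 W V Y • X + det3 W X V • Y := by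
  ext i
  fin_cases i <;> simp [det3, Matrix.det_fin_three] <;> ring

/-- Explicit formula for the operator `Sᵢ` from the infinitesimal monodromy computation:
if `S X = 0`, `S Y = 0`, `S Z = −b·X − c·W`, then
`S V = (det(V,X,Y)/det(W,X,Y))·(−W − (b/c)·X)`. -/
theorem Si_formula (W X Y Z : Fin 3 → ℝ) (a b c : ℝ)
    (hZ : Z = a • Y + b • X + c • W)
    (hdet : det3 W X Y ≠ 0) (hc : c ≠ 0)
    (S : (Fin 3 → ℝ) →ₗ[ℝ] (Fin 3 → ℝ))
    (hSX : S X = 0) (hSY : S Y = 0) (hSZ : S Z = -(b • X) - c • W) :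
    ∀ V : Fin 3 → ℝ,
      S V = (det3 V X Y / det3 W X Y) • (-W - (b / c) • X) := by
  intro V
  have hSW : S W = -W - (b / c) • X := by
    have h : c • S W = c • (-W - (b / c) • X) := by
      have h' := hSZ
      rw [hZ, map_add, map_add, map_smul, map_smul, map_smul, hSX, hSY, smul_zero, smul_zero,
        zero_add, zero_add] at h'
      rw [h', smul_sub, smul_smul, mul_div_cancel₀ b hc, smul_neg]
      abel
    exact smul_right_injective _ hc h
  have hV := congrArg S (det3_smul_eq W X Y V)
  rw [map_smul, map_add, map_add, map_smul, map_smul, map_smul, hSX, hSY, smul_zero, smul_zero,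
    add_zero, add_zero, hSW] at hV
  rw [div_eq_inv_mul, mul_smul, ← hV, inv_smul_smul₀ hdet]
end

section
/- Let n ≥ 3 and let V : ZMod n → ℝ³ satisfy det(V_{i-1}, V_i, V_{i+1}) ≠ 0 for all i, with Glick's operator G. Let V' : ZMod n → ℝ³ be a family of nonzero vectors such that for every i, V'_i lies in span{V_{i-1}, V_{i+1}} ∩ span{V_i, V_{i+2}} (so the projections of V'_i are the vertices of the image of the polygon under the pentagram map), and suppose det(V'_{i-1}, V'_i, V'_{i+1}) ≠ 0 for all i; let G' be Glick's operator of V'. Then G' − G is a scalar multiple of the identity. (The infinitesimal monodromy, equivalently Glick's operator viewed as an element of the projective Lie algebra, is preserved by the pentagram map.) -/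
lemma det3_expand (A B C : Fin 3 → ℝ) :
    det3 A B C = A 0 * (B 1 * C 2 - B 2 * C 1) - A 1 * (B 0 * C 2 - B 2 * C 0)
      + A 2 * (B 0 * C 1 - B 1 * C 0) := by
  simp only [det3, Matrix.det_fin_three, Matrix.transpose_apply, Matrix.of_apply,
    Matrix.cons_val]
  ring

lemma det3_cycle (A B C : Fin 3 → ℝ) : det3 B C A = det3 A B C := by
  simp only [det3_expand]
  ring

/-- Cramer's rule. -/
lemma det3_smul_eq_s18 (A B C X : Fin 3 → ℝ) :
    det3 A B C • X = det3 B C X • A + det3 A X C • B + det3 A B X • C := by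
  rw [funext_iff, Fin.forall_fin_succ, Fin.forall_fin_two]
  simp only [det3_expand, Pi.add_apply, Pi.smul_apply, smul_eq_mul, Fin.succ_zero_eq_one,
    Fin.succ_one_eq_two]
  exact ⟨by ring, by ring, by ring⟩

/-- Vectors in a common plane `span {U, T}` have determinant proportional to that of `U, T`. -/
lemma exists_det3_eq_mul_of_mem_span_pair {U T B C : Fin 3 → ℝ}
    (hB : B ∈ Submodule.span ℝ {U, T}) (hC : C ∈ Submodule.span ℝ {U, T}) :
    ∃ k : ℝ, ∀ Y, det3 B C Y = k * det3 U Y T := by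
  obtain ⟨p, q, rfl⟩ := Submodule.mem_span_pair.1 hB
  obtain ⟨r, s, rfl⟩ := Submodule.mem_span_pair.1 hC
  refine ⟨q * r - p * s, fun Y => ?_⟩
  simp only [det3_expand, Pi.add_apply, Pi.smul_apply, smul_eq_mul]
  ring

lemma det3_self_left_s18 (U T : Fin 3 → ℝ) : det3 U U T = 0 := by
  rw [det3_expand]
  ring

lemma det3_self_right_s18 (U T : Fin 3 → ℝ) : det3 U T T = 0 := by
  rw [det3_expand]
  ring

/-- If `X` is the intersection of the lines `AB` and `CE`, the projection onto `B` along `AC`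
differs from the projection onto `X` along `BC` by two further projections. -/
lemma projection_eq_of_intersection {A B C E X : Fin 3 → ℝ} (hABX : det3 A B X = 0)
    (hCEX : det3 C E X = 0) (hABC : det3 A B C ≠ 0) (hBCE : det3 B C E ≠ 0)
    (hBCX : det3 B C X ≠ 0) (W : Fin 3 → ℝ) :
    (det3 A W C / det3 A B C) • B = (det3 C E W / det3 C E B) • B
      - (det3 B C W / det3 B C A) • A + (det3 B C W / det3 B C X) • X := by
  have hX : X = (det3 A B C)⁻¹ • (det3 B C X • A + det3 A X C • B) := by
    rw [eq_inv_smul_iff₀ hABC, det3_smul_eq_s18, hABX, zero_smul, add_zero]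
  have key : det3 A W C * det3 B C E * det3 B C X =
      det3 C E W * det3 A B C * det3 B C X + det3 B C W * det3 A X C * det3 B C E := by
    have h : det3 A W C * det3 B C E * det3 B C X -
        (det3 C E W * det3 A B C * det3 B C X + det3 B C W * det3 A X C * det3 B C E) =
        -(det3 A B C * det3 B C W * det3 C E X) := by
      simp only [det3_expand]
      ring
    rw [hCEX, mul_zero, neg_zero] at h
    exact sub_eq_zero.1 h
  have hcoef : det3 A W C / det3 A B C = det3 C E W / det3 B C E +
      det3 B C W / det3 B C X * ((det3 A B C)⁻¹ * det3 A X C) := by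
    field_simp
    linear_combination key
  have hA : det3 B C W / det3 B C X * ((det3 A B C)⁻¹ * det3 B C X) =
      det3 B C W / det3 A B C := by
    field_simp
  rw [det3_cycle B C E, det3_cycle A B C, hcoef]
  conv_rhs => rw [show (det3 B C W / det3 B C X) • X = (det3 B C W / det3 B C X) •
    ((det3 A B C)⁻¹ • (det3 B C X • A + det3 A X C • B)) from congrArg _ hX]
  simp only [smul_add, smul_smul, add_smul]
  rw [hA]
  abel

/-- Glick's operator, viewed modulo scalar matrices, is preserved by the pentagram map:
if `V'ᵢ` are lifts of the vertices of the pentagram-map image (i.e. nonzero vectors in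
`span{V_{i-1}, V_{i+1}} ∩ span{V_i, V_{i+2}}`), then `G' − G` is a scalar multiple of the
identity. -/
theorem glick_preserved_by_pentagram_map (n : ℕ) (hn : 3 ≤ n)
    (V V' : ZMod n → Fin 3 → ℝ)
    (hV : ∀ i : ZMod n, det3 (V (i - 1)) (V i) (V (i + 1)) ≠ 0)
    (hV'ne : ∀ i : ZMod n, V' i ≠ 0)
    (hmem : ∀ i : ZMod n, V' i ∈
      Submodule.span ℝ {V (i - 1), V (i + 1)} ⊓ Submodule.span ℝ {V i, V (i + 2)})
    (hV' : ∀ i : ZMod n, det3 (V' (i - 1)) (V' i) (V' (i + 1)) ≠ 0) :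
    ∃ lam : ℝ, ∀ W : Fin 3 → ℝ, glick n V' W - glick n V W = lam • W := by
  refine ⟨0, fun W => ?_⟩
  let P (U : ZMod n → Fin 3 → ℝ) (i : ZMod n) : Fin 3 → ℝ :=
    (det3 (U (i - 1)) W (U (i + 1)) / det3 (U (i - 1)) (U i) (U (i + 1))) • U i
  let S (i : ZMod n) : Fin 3 → ℝ :=
    (det3 (V' i) (V' (i + 1)) W / det3 (V' i) (V' (i + 1)) (V' (i - 1))) • V' (i - 1)
  have hstep (i : ZMod n) : P V' i = S (i + 1) - S i + P V (i + 1) := by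
    have e₁ : i + 1 + 1 = i + 2 := by ring
    have e₂ : i - 1 + 2 = i + 1 := by ring
    have e₃ : i + 2 - 1 = i + 1 := by ring
    have e₄ : i + 2 + 1 = i + 1 + 2 := by ring
    have hB₁ := (hmem i).1
    have hB₂ := (hmem i).2
    have hA := (hmem (i - 1)).2
    have hC₁ := (hmem (i + 1)).1
    have hC₂ := (hmem (i + 1)).2
    have hE := (hmem (i + 2)).1
    rw [e₂] at hA
    rw [add_sub_cancel_right, e₁] at hC₁
    rw [e₃, e₄] at hE
    have hBCE := hV' (i + 1)
    have hX := hV (i + 1)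
    rw [add_sub_cancel_right, e₁] at hBCE hX
    have hABC := hV' i
    obtain ⟨k, hk⟩ := exists_det3_eq_mul_of_mem_span_pair hB₂ hC₁
    obtain ⟨l, hl⟩ := exists_det3_eq_mul_of_mem_span_pair hA hB₁
    obtain ⟨m, hm⟩ := exists_det3_eq_mul_of_mem_span_pair hC₂ hE
    have hk0 : k ≠ 0 := by
      rintro rfl
      exact hABC (by rw [← det3_cycle, hk, zero_mul])
    have h := projection_eq_of_intersection (X := V (i + 1))
      (by rw [hl, det3_self_right_s18, mul_zero]) (by rw [hm, det3_self_left_s18, mul_zero])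
      hABC hBCE (by rw [hk]; exact mul_ne_zero hk0 hX) W
    rw [show det3 (V' i) (V' (i + 1)) W / det3 (V' i) (V' (i + 1)) (V (i + 1)) =
      det3 (V i) W (V (i + 2)) / det3 (V i) (V (i + 1)) (V (i + 2)) by
        rw [hk, hk, mul_div_mul_left _ _ hk0]] at h
    simpa only [P, S, add_sub_cancel_right, e₁] using h
  have htel : ∑ i ∈ Finset.range n, (P V' i - P V i) = 0 := by
    have h (i : ℕ) : P V' i - P V i =
        (S ((i + 1 : ℕ) : ZMod n) + P V ((i + 1 : ℕ) : ZMod n)) - (S i + P V i) := by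
      rw [hstep]
      push_cast
      abel
    rw [Finset.sum_congr rfl fun i _ => h i,
      Finset.sum_range_sub fun i : ℕ => S (i : ZMod n) + P V (i : ZMod n)]
    simp
  rw [Finset.sum_sub_distrib, sub_eq_zero] at htel
  change ((n : ℝ) • W - ∑ i ∈ Finset.range n, P V' i) -
    ((n : ℝ) • W - ∑ i ∈ Finset.range n, P V i) = (0 : ℝ) • W
  rw [htel, sub_self, zero_smul]
end
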